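/- (Theorem 3, even case) Fix τ ∈ ℂ with Im τ > 0 and an integer l ≥ 1; set n = 2l. Then for every z ∈ ℂ, θ₁(2lz|τ) = C̃ · ( ∏_{m=-(l-1)}^{l} θ₄(z + mπ/(2l) | τ) ) · ( ∏_{k=-(l-1)}^{l} ∏_{j=-(l-1)}^{l-1} θ₁(z + kπ/(2l) + jπτ/(2l) | τ) ), where C̃ is the nonzero constant determined by C̃⁻¹ = (1/(2l)) · ( ∏_{m=-(l-1)}^{l} θ₄(mπ/(2l) | τ) ) · ( ∏_{k=-(l-1)}^{l} ∏_{j=-(l-1), (k,j)≠(0,0)}^{l-1} θ₁(kπ/(2l) + jπτ/(2l) | τ) ). -/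

import Mathlib

/-- Jacobi theta function θ₁(z|τ), nome q = exp(iπτ). -/
noncomputable def theta1 (z τ : ℂ) : ℂ :=
  2 * ∑' n : ℕ, (-1) ^ n * Complex.exp (Real.pi * Complex.I * τ * ((n : ℂ) + 1 / 2) ^ 2) *
      Complex.sin ((2 * (n : ℂ) + 1) * z)

/-- Jacobi theta function θ₄(z|τ). -/
noncomputable def theta4 (z τ : ℂ) : ℂ :=
  1 + 2 * ∑' n : ℕ, (-1) ^ (n + 1) * Complex.exp (Real.pi * Complex.I * τ * ((n : ℂ) + 1) ^ 2) *
      Complex.cos (2 * ((n : ℂ) + 1) * z)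

open Complex Filter Topology in
/-- The integral over a period of a `1`-periodic entire function does not depend on the
horizontal line along which it is taken. -/
lemma integral_add_const_of_periodic {F : ℂ → ℂ} (hF : Differentiable ℂ F)
    (hper : ∀ z, F (z + 1) = F z) (w : ℂ) :
    ∫ x in (0 : ℝ)..1, F (x + w) = ∫ x in (0 : ℝ)..1, F x := by
  obtain ⟨G, hG⟩ := (hF.differentiableOn (s := Metric.ball 0 (‖w‖ + 3))).isExactOn_ball
  have key : ∀ v ∈ Metric.ball (0 : ℂ) (‖w‖ + 1),
      ∫ x in (0 : ℝ)..1, F (x + v) = G (v + 1) - G v := by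
    intro v hv
    rw [mem_ball_zero_iff] at hv
    have h := intervalIntegral.integral_eq_sub_of_hasDerivAt (a := (0 : ℝ)) (b := 1)
      (f := fun x : ℝ ↦ G (x + v)) (f' := fun x : ℝ ↦ F (x + v)) (fun x hx ↦ ?_) ?_
    · simpa [add_comm] using h
    · rw [Set.uIcc_of_le zero_le_one] at hx
      have hmem : (x : ℂ) + v ∈ Metric.ball (0 : ℂ) (‖w‖ + 3) := by
        rw [mem_ball_zero_iff]
        have h1 : ‖(x : ℂ)‖ ≤ 1 := by
          rw [Complex.norm_real, Real.norm_eq_abs, abs_of_nonneg hx.1]; exact hx.2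
        linarith [norm_add_le (x : ℂ) v]
      simpa using ((hG _ hmem).comp_add_const (x : ℂ) v).comp_ofReal
    · have := hF.continuous
      exact Continuous.intervalIntegrable (by fun_prop) _ _
  have hderiv : ∀ v ∈ Metric.ball (0 : ℂ) (‖w‖ + 1),
      HasDerivAt (fun v ↦ G (v + 1) - G v) 0 v := by
    intro v hv
    rw [mem_ball_zero_iff] at hv
    have h1 : v + 1 ∈ Metric.ball (0 : ℂ) (‖w‖ + 3) := by
      rw [mem_ball_zero_iff]
      have := norm_add_le v 1
      rw [norm_one] at this
      linarith
    have h2 : v ∈ Metric.ball (0 : ℂ) (‖w‖ + 3) := by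
      rw [mem_ball_zero_iff]; linarith
    have h := ((hG _ h1).comp_add_const v 1).sub (hG _ h2)
    rw [hper, sub_self] at h
    exact h
  have h0 : (0 : ℂ) ∈ Metric.ball (0 : ℂ) (‖w‖ + 1) := by
    rw [mem_ball_zero_iff, norm_zero]; positivity
  have hw : w ∈ Metric.ball (0 : ℂ) (‖w‖ + 1) := by
    rw [mem_ball_zero_iff]; linarith
  have hconst := Metric.isOpen_ball.is_const_of_deriv_eq_zero
    (convex_ball (0 : ℂ) (‖w‖ + 1)).isPreconnected
    (fun v hv ↦ (hderiv v hv).differentiableAt.differentiableWithinAt)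
    (fun v hv ↦ (hderiv v hv).deriv) hw h0
  rw [key w hw, hconst, ← key 0 h0]
  simp

open Complex Filter Topology Real in
/-- An entire function with the quasi-periods of `jacobiTheta₂ · τ` is a multiple of it. -/
lemma exists_eq_const_mul_jacobiTheta₂ {τ : ℂ} (hτ : 0 < τ.im) {f : ℂ → ℂ}
    (hf : Differentiable ℂ f) (hper : ∀ z, f (z + 1) = f z)
    (hquasi : ∀ z, f (z + τ) = cexp (-π * I * (τ + 2 * z)) * f z) :
    ∃ c, ∀ z, f z = c * jacobiTheta₂ z τ := by
  set a : ℤ → ℂ := fun n ↦ ∫ x in (0 : ℝ)..1, cexp (-2 * π * I * n * x) * f x with ha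
  have hstep : ∀ n : ℤ, a (n + 1) = cexp (π * I * (2 * n + 1) * τ) * a n := by
    intro n
    have hF : Differentiable ℂ fun z ↦ cexp (-2 * π * I * n * z) * f z := by fun_prop
    have hFper : ∀ z, cexp (-2 * π * I * n * (z + 1)) * f (z + 1) =
        cexp (-2 * π * I * n * z) * f z := by
      intro z
      rw [hper, mul_add, Complex.exp_add,
        show -2 * π * I * n * 1 = ((-n : ℤ) : ℂ) * (2 * π * I) by push_cast; ring,
        Complex.exp_int_mul_two_pi_mul_I, mul_one]
    have h := integral_add_const_of_periodic hF hFper τ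
    have hint : ∀ x : ℝ, cexp (-2 * π * I * n * (x + τ)) * f (x + τ) =
        cexp (-(π * I * (2 * n + 1) * τ)) * (cexp (-2 * π * I * (n + 1 : ℤ) * x) * f x) := by
      intro x
      rw [hquasi, ← mul_assoc, ← mul_assoc, ← Complex.exp_add, ← Complex.exp_add]
      congr 2
      push_cast
      ring
    simp_rw [hint, intervalIntegral.integral_const_mul] at h
    change cexp (-(π * I * (2 * n + 1) * τ)) * a (n + 1) = a n at h
    rw [← h, ← mul_assoc, ← Complex.exp_add, add_neg_cancel, Complex.exp_zero, one_mul]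
  have hcoeff : ∀ n : ℤ, a n = a 0 * cexp (π * I * n ^ 2 * τ) := by
    intro n
    induction n with
    | zero => simp
    | succ n ih =>
      rw [hstep, ih, mul_left_comm, ← Complex.exp_add]
      congr 2
      push_cast
      ring
    | pred n ih =>
      have h := hstep (-(n : ℤ) - 1)
      rw [sub_add_cancel, ih] at h
      refine mul_left_cancel₀ (Complex.exp_ne_zero _) (h.symm.trans ?_)
      rw [mul_left_comm, ← Complex.exp_add]
      congr 2
      push_cast
      ring
  have hfR : Continuous fun x : ℝ ↦ f x := hf.continuous.comp continuous_ofReal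
  have hfper : Function.Periodic (fun x : ℝ ↦ f x) 1 := fun x ↦ by simp [hper]
  let g : C(AddCircle (1 : ℝ), ℂ) := ⟨hfper.lift, hfR.quotient_lift _⟩
  have hg : ∀ n, fourierCoeff g n = a n := by
    intro n
    rw [fourierCoeff_eq_intervalIntegral _ n 0, zero_add, one_div, inv_one, one_smul]
    refine intervalIntegral.integral_congr fun x _ ↦ ?_
    simp only [fourier_coe_apply, smul_eq_mul]
    congr 1
    congr 1
    push_cast
    ring
  have hJ : ∀ x : ℂ, HasSum (fun n : ℤ ↦ a n * cexp (2 * π * I * n * x))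
      (a 0 * jacobiTheta₂ x τ) := by
    intro x
    refine ((hasSum_jacobiTheta₂_term x hτ).mul_left (a 0)).congr_fun fun n ↦ ?_
    rw [hcoeff, jacobiTheta₂_term, mul_assoc, ← Complex.exp_add, add_comm]
  have hreal : ∀ x : ℝ, f x = a 0 * jacobiTheta₂ x τ := by
    intro x
    have hsum : Summable (fourierCoeff g) := by
      exact (hJ 0).summable.congr fun n ↦ by simp [hg]
    have h := has_pointwise_sum_fourier_series_of_summable hsum (x : AddCircle (1 : ℝ))
    refine h.unique ?_
    refine (hJ x).congr_fun fun n ↦ ?_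
    simp [hg]
  refine ⟨a 0, fun z ↦ ?_⟩
  have hJd : Differentiable ℂ fun z ↦ a 0 * jacobiTheta₂ z τ := fun z ↦
    (differentiableAt_jacobiTheta₂_fst z hτ).const_mul _
  refine congr_fun (AnalyticOnNhd.eq_of_frequently_eq (z₀ := 0)
    (fun z _ ↦ hf.analyticAt z) (fun z _ ↦ hJd.analyticAt z) ?_) z
  have hlim : Tendsto (fun x : ℝ ↦ (x : ℂ)) (𝓝[≠] 0) (𝓝[≠] 0) := by
    refine tendsto_nhdsWithin_iff.mpr ⟨?_, ?_⟩
    · exact (continuous_ofReal.tendsto' 0 0 (by simp)).mono_left nhdsWithin_le_nhds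
    · filter_upwards [self_mem_nhdsWithin] with x hx
      simpa using hx
  exact hlim.frequently (Eventually.of_forall fun x ↦ hreal x).frequently

/-- The `q`-Pochhammer symbol `(x; p)_∞ = ∏ (1 - pⁿ x)`. -/
noncomputable def pochhammerProd (p x : ℂ) : ℂ := ∏' n : ℕ, (1 + -(p ^ n * x))

section pochhammerProd

variable {p : ℂ}

lemma summable_norm_neg_pow_mul (hp : ‖p‖ < 1) (x : ℂ) :
    Summable fun n : ℕ ↦ ‖-(p ^ n * x)‖ := by
  simpa using (summable_geometric_of_lt_one (norm_nonneg p) hp).mul_right ‖x‖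

lemma pochhammerProd_eq_mul (hp : ‖p‖ < 1) (x : ℂ) :
    pochhammerProd p x = (1 - x) * pochhammerProd p (p * x) := by
  have h : Multipliable fun n : ℕ ↦ 1 + -(p ^ (n + 1) * x) := by
    simpa only [pow_succ, mul_assoc] using
      multipliable_one_add_of_summable (summable_norm_neg_pow_mul hp (p * x))
  rw [pochhammerProd, tprod_eq_zero_mul' (f := fun n ↦ 1 + -(p ^ n * x)) h, pochhammerProd]
  simp only [pow_succ, pow_zero, one_mul, mul_assoc, sub_eq_add_neg]

lemma pochhammerProd_ne_zero (hp : ‖p‖ < 1) {x : ℂ} (hx : ‖x‖ < 1) :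
    pochhammerProd p x ≠ 0 := by
  refine tprod_one_add_ne_zero_of_summable (fun n h ↦ ?_) (summable_norm_neg_pow_mul hp x)
  have h1 : p ^ n * x = 1 := by linear_combination -h
  have h2 : ‖p ^ n * x‖ < 1 := by
    rw [norm_mul, norm_pow]
    exact mul_lt_one_of_nonneg_of_lt_one_right (pow_le_one₀ (norm_nonneg p) hp.le)
      (norm_nonneg x) hx
  rw [h1, norm_one] at h2
  exact lt_irrefl _ h2

lemma differentiable_pochhammerProd (hp : ‖p‖ < 1) :
    Differentiable ℂ (pochhammerProd p) := by
  intro x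
  have hprod := Summable.hasProdLocallyUniformlyOn_nat_one_add (f := fun n y ↦ -(p ^ n * y))
    (Metric.isOpen_ball (x := (0 : ℂ)) (ε := ‖x‖ + 1))
    ((summable_geometric_of_lt_one (norm_nonneg p) hp).mul_right (‖x‖ + 1))
    (.of_forall fun n y hy ↦ ?_) (fun n ↦ by fun_prop)
  · refine (hprod.differentiableOn (.of_forall fun s ↦ ?_) Metric.isOpen_ball).differentiableAt
      (Metric.isOpen_ball.mem_nhds (by simp))
    simpa [Finset.prod_fn] using DifferentiableOn.finsetProd (fun _ _ ↦ by fun_prop)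
  · rw [mem_ball_zero_iff] at hy
    rw [norm_neg, norm_mul, norm_pow]
    gcongr

end pochhammerProd

section theta

open Complex Real Filter Topology Finset

variable {τ : ℂ}

lemma norm_cexp_two_pi_mul_I_mul_lt_one (hτ : 0 < τ.im) : ‖cexp (2 * π * I * τ)‖ < 1 := by
  rw [Complex.norm_exp, Real.exp_lt_one_iff]
  have : 0 < 2 * π * τ.im := by positivity
  simpa using this

/-- The Jacobi triple product, with an unspecified nonzero constant. -/
lemma exists_jacobiTheta₂_eq_product (hτ : 0 < τ.im) :
    ∃ c ≠ 0, ∀ z, jacobiTheta₂ z τ =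
      c * (pochhammerProd (cexp (2 * π * I * τ)) (-cexp (π * I * (τ + 2 * z))) *
        pochhammerProd (cexp (2 * π * I * τ)) (-cexp (π * I * (τ - 2 * z)))) := by
  have hp := norm_cexp_two_pi_mul_I_mul_lt_one hτ
  set p := cexp (2 * π * I * τ) with hpdef
  have hE := differentiable_pochhammerProd hp
  have hexp : ∀ {u v : ℂ} (n : ℤ), u = v + n * (2 * π * I) → cexp u = cexp v := by
    rintro u v n rfl
    rw [Complex.exp_add, Complex.exp_int_mul_two_pi_mul_I, mul_one]
  suffices h : ∃ c, ∀ z, pochhammerProd p (-cexp (π * I * (τ + 2 * z))) *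
      pochhammerProd p (-cexp (π * I * (τ - 2 * z))) = c * jacobiTheta₂ z τ by
    obtain ⟨c, hc⟩ := h
    have hc0 : c ≠ 0 := by
      rintro rfl
      have h0 := hc 0
      have hq : ‖-cexp (π * I * τ)‖ < 1 := by
        rw [norm_neg, Complex.norm_exp, Real.exp_lt_one_iff]
        have : 0 < π * τ.im := by positivity
        simpa using this
      simp only [mul_zero, add_zero, sub_zero, zero_mul, mul_self_eq_zero] at h0
      exact pochhammerProd_ne_zero hp hq h0
    exact ⟨c⁻¹, inv_ne_zero hc0, fun z ↦ by rw [hc, inv_mul_cancel_left₀ hc0]⟩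
  refine exists_eq_const_mul_jacobiTheta₂ hτ (by fun_prop) (fun z ↦ ?_) (fun z ↦ ?_)
  · rw [hexp (u := π * I * (τ + 2 * (z + 1))) (v := π * I * (τ + 2 * z)) 1 (by push_cast; ring),
      hexp (u := π * I * (τ - 2 * (z + 1))) (v := π * I * (τ - 2 * z)) (-1) (by push_cast; ring)]
  · rw [pochhammerProd_eq_mul hp (-cexp (π * I * (τ + 2 * z))),
      pochhammerProd_eq_mul hp (-cexp (π * I * (τ - 2 * (z + τ)))),
      show p * -cexp (π * I * (τ + 2 * z)) = -cexp (π * I * (τ + 2 * (z + τ))) by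
        rw [hpdef, mul_neg, ← Complex.exp_add]; ring_nf,
      show p * -cexp (π * I * (τ - 2 * (z + τ))) = -cexp (π * I * (τ - 2 * z)) by
        rw [hpdef, mul_neg, ← Complex.exp_add]; ring_nf,
      show π * I * (τ - 2 * (z + τ)) = -π * I * (τ + 2 * z) by ring]
    have h : cexp (-π * I * (τ + 2 * z)) * cexp (π * I * (τ + 2 * z)) = 1 := by
      rw [← Complex.exp_add, ← Complex.exp_zero]; ring_nf
    linear_combination (-pochhammerProd p (-cexp (π * I * (τ + 2 * (z + τ)))) *
      pochhammerProd p (-cexp (π * I * (τ - 2 * z)))) * h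

lemma theta1_eq_jacobiTheta₂ (hτ : 0 < τ.im) (z : ℂ) :
    theta1 z τ =
      -I * cexp (I * z + π * I * τ / 4) * jacobiTheta₂ (z / π + τ / 2 + 1 / 2) τ := by
  have h := ((hasSum_jacobiTheta₂_term (z / π + τ / 2 + 1 / 2) hτ).nat_add_neg_add_one).mul_left
    (-I * cexp (I * z + π * I * τ / 4))
  rw [← h.tsum_eq, theta1, ← tsum_mul_left]
  refine tsum_congr fun n ↦ ?_
  have hπ : (π : ℂ) ≠ 0 := by exact_mod_cast Real.pi_ne_zero
  have hneg : ∀ m : ℤ, cexp (π * I * m) = (-1) ^ m := fun m ↦ by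
    rw [mul_comm, Complex.exp_int_mul, Complex.exp_pi_mul_I]
  have h1 : cexp (I * z + π * I * τ / 4) * jacobiTheta₂_term n (z / π + τ / 2 + 1 / 2) τ =
      (-1) ^ n * cexp (π * I * τ * (n + 1 / 2) ^ 2) * cexp ((2 * n + 1) * z * I) := by
    have := hneg n
    rw [zpow_natCast] at this
    rw [← this, jacobiTheta₂_term, ← Complex.exp_add, ← Complex.exp_add, ← Complex.exp_add]
    congr 1
    push_cast
    field_simp
    ring
  have h2 : cexp (I * z + π * I * τ / 4) *
      jacobiTheta₂_term (-(n + 1)) (z / π + τ / 2 + 1 / 2) τ =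
      -((-1) ^ n * cexp (π * I * τ * (n + 1 / 2) ^ 2) * cexp (-((2 * n + 1) * z) * I)) := by
    have h3 : cexp (π * I * (-(n + 1) : ℤ)) = -(-1) ^ n := by
      rw [hneg, zpow_neg, ← inv_zpow, inv_neg_one]
      rw [← Nat.cast_succ, zpow_natCast, pow_succ, mul_neg_one]
    rw [neg_mul_eq_neg_mul, neg_mul_eq_neg_mul, ← h3, jacobiTheta₂_term, ← Complex.exp_add,
      ← Complex.exp_add, ← Complex.exp_add]
    congr 1
    push_cast
    field_simp
    ring
  rw [mul_add, mul_assoc (-I), mul_assoc (-I), h1, h2, Complex.sin]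
  ring

lemma theta4_eq_jacobiTheta₂ (hτ : 0 < τ.im) (z : ℂ) :
    theta4 z τ = jacobiTheta₂ (z / π + 1 / 2) τ := by
  have h := (hasSum_jacobiTheta₂_term (z / π + 1 / 2) hτ).nat_add_neg
  have hπ : (π : ℂ) ≠ 0 := by exact_mod_cast Real.pi_ne_zero
  have hterm : ∀ n : ℕ, jacobiTheta₂_term n (z / π + 1 / 2) τ +
      jacobiTheta₂_term (-n) (z / π + 1 / 2) τ =
      2 * ((-1) ^ n * cexp (π * I * τ * n ^ 2) * Complex.cos (2 * n * z)) := by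
    intro n
    have hn : cexp (n * (π * I)) = (-1) ^ n := by
      rw [Complex.exp_nat_mul, Complex.exp_pi_mul_I]
    have hn' : cexp (-(n * (π * I))) = (-1) ^ n := by
      rw [Complex.exp_neg, hn, ← inv_pow, inv_neg_one]
    have h1 : jacobiTheta₂_term n (z / π + 1 / 2) τ =
        (-1) ^ n * cexp (π * I * τ * n ^ 2) * cexp (2 * n * z * I) := by
      rw [← hn, jacobiTheta₂_term, ← Complex.exp_add, ← Complex.exp_add]
      congr 1
      push_cast
      field_simp
      ring
    have h2 : jacobiTheta₂_term (-n) (z / π + 1 / 2) τ =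
        (-1) ^ n * cexp (π * I * τ * n ^ 2) * cexp (-(2 * n * z) * I) := by
      rw [← hn', jacobiTheta₂_term, ← Complex.exp_add, ← Complex.exp_add]
      congr 1
      push_cast
      field_simp
      ring
    rw [h1, h2, Complex.cos]
    ring
  have h0 : jacobiTheta₂_term 0 (z / π + 1 / 2) τ = 1 := by simp [jacobiTheta₂_term]
  have h3 := h.tsum_eq
  rw [h.summable.tsum_eq_zero_add, h0] at h3
  simp only [hterm, tsum_mul_left] at h3
  rw [theta4]
  push_cast at h3
  simp only [pow_zero, mul_zero, zero_mul, Complex.exp_zero, Complex.cos_zero, mul_one, ne_eq,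
    OfNat.ofNat_ne_zero, not_false_eq_true, zero_pow] at h3
  linear_combination h3

lemma differentiable_theta1 (hτ : 0 < τ.im) : Differentiable ℂ fun z ↦ theta1 z τ := by
  have hJ : Differentiable ℂ fun z ↦ jacobiTheta₂ z τ := fun z ↦
    differentiableAt_jacobiTheta₂_fst z hτ
  simp_rw [theta1_eq_jacobiTheta₂ hτ]
  exact (by fun_prop : Differentiable ℂ fun z ↦ -I * cexp (I * z + π * I * τ / 4)).mul
    (hJ.comp (by fun_prop : Differentiable ℂ fun z : ℂ ↦ z / π + τ / 2 + 1 / 2))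

lemma theta1_add_pi (hτ : 0 < τ.im) (z : ℂ) : theta1 (z + π) τ = -theta1 z τ := by
  have hπ : (π : ℂ) ≠ 0 := by exact_mod_cast Real.pi_ne_zero
  rw [theta1_eq_jacobiTheta₂ hτ, theta1_eq_jacobiTheta₂ hτ,
    show (z + π) / π + τ / 2 + 1 / 2 = (z / π + τ / 2 + 1 / 2) + 1 by field_simp; ring,
    jacobiTheta₂_add_left,
    show I * (z + π) + π * I * τ / 4 = I * z + π * I * τ / 4 + π * I by ring,
    Complex.exp_add _ (π * I), Complex.exp_pi_mul_I]
  ring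

lemma theta1_add_pi_mul (hτ : 0 < τ.im) (z : ℂ) :
    theta1 (z + π * τ) τ = -cexp (-(π * I * τ + 2 * I * z)) * theta1 z τ := by
  have hπ : (π : ℂ) ≠ 0 := by exact_mod_cast Real.pi_ne_zero
  rw [theta1_eq_jacobiTheta₂ hτ, theta1_eq_jacobiTheta₂ hτ,
    show (z + π * τ) / π + τ / 2 + 1 / 2 = (z / π + τ / 2 + 1 / 2) + τ by field_simp; ring,
    jacobiTheta₂_add_left',
    show -π * I * (τ + 2 * (z / π + τ / 2 + 1 / 2)) =
      -(π * I * τ + 2 * I * z) + -(π * I * τ) + -(π * I) by field_simp; ring,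
    show I * (z + π * τ) + π * I * τ / 4 = I * z + π * I * τ / 4 + π * I * τ by ring,
    Complex.exp_add _ (-(π * I)), Complex.exp_add _ (-(π * I * τ)), Complex.exp_add _ (π * I * τ),
    Complex.exp_neg (π * I), Complex.exp_pi_mul_I, Complex.exp_neg (π * I * τ)]
  field_simp

lemma theta4_eq_theta1 (hτ : 0 < τ.im) (z : ℂ) :
    theta4 z τ = -I * cexp (I * z + π * I * τ / 4) * theta1 (z + π * τ / 2) τ := by
  have hπ : (π : ℂ) ≠ 0 := by exact_mod_cast Real.pi_ne_zero
  rw [theta1_eq_jacobiTheta₂ hτ, theta4_eq_jacobiTheta₂ hτ,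
    show (z + π * τ / 2) / π + τ / 2 + 1 / 2 = (z / π + 1 / 2) + τ by field_simp; ring,
    jacobiTheta₂_add_left']
  rw [show ∀ a b c d : ℂ, -I * cexp a * (-I * cexp b * (cexp c * d)) =
      I * I * cexp (a + b + c) * d by intro a b c d; simp only [Complex.exp_add]; ring,
    show I * z + π * I * τ / 4 + (I * (z + π * τ / 2) + π * I * τ / 4) +
      -π * I * (τ + 2 * (z / π + 1 / 2)) = -(π * I) by field_simp; ring,
    Complex.exp_neg, Complex.exp_pi_mul_I, I_mul_I]
  norm_num

/-- The zero of `theta1 · τ` at the origin is simple. -/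
lemma exists_hasDerivAt_theta1_zero (hτ : 0 < τ.im) :
    ∃ d ≠ 0, HasDerivAt (fun z ↦ theta1 z τ) d 0 := by
  obtain ⟨c, hc, hJ⟩ := exists_jacobiTheta₂_eq_product hτ
  have hp := norm_cexp_two_pi_mul_I_mul_lt_one hτ
  set p := cexp (2 * π * I * τ) with hpdef
  have hπ : (π : ℂ) ≠ 0 := by exact_mod_cast Real.pi_ne_zero
  have hE := differentiable_pochhammerProd hp
  set S : ℂ → ℂ := fun z ↦ -I * cexp (I * z + π * I * τ / 4) *
    (c * (pochhammerProd p (p * cexp (2 * I * z)) *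
      pochhammerProd p (p * cexp (-(2 * I * z))))) with hS
  have hSd : Differentiable ℂ S := by fun_prop
  have hfac : ∀ z, theta1 z τ = (1 - cexp (-(2 * I * z))) * S z := by
    intro z
    rw [theta1_eq_jacobiTheta₂ hτ, hJ,
      show π * I * (τ + 2 * (z / π + τ / 2 + 1 / 2)) = 2 * π * I * τ + 2 * I * z + π * I by
        field_simp; ring,
      show π * I * (τ - 2 * (z / π + τ / 2 + 1 / 2)) = -(2 * I * z) + -(π * I) by
        field_simp; ring,
      Complex.exp_add _ (π * I), Complex.exp_add _ (-(π * I)), Complex.exp_neg (π * I),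
      Complex.exp_pi_mul_I, Complex.exp_add (2 * π * I * τ), ← hpdef, mul_neg_one, neg_neg,
      inv_neg_one, mul_neg_one, neg_neg, pochhammerProd_eq_mul hp (cexp (-(2 * I * z)))]
    simp only [hS]
    ring
  have hd : HasDerivAt (fun z : ℂ ↦ 1 - cexp (-(2 * I * z))) (2 * I) 0 := by
    have h := ((((hasDerivAt_id (0 : ℂ)).const_mul (2 * I)).neg).cexp).const_sub 1
    simpa using h
  have h := hd.mul (hSd 0).hasDerivAt
  refine ⟨2 * I * S 0, ?_, ?_⟩
  · have hS0 : S 0 ≠ 0 := by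
      have hpp := pochhammerProd_ne_zero hp hp
      simp [hS, hc, hpp]
    simpa using hS0
  · simp_rw [hfac]
    refine h.congr_deriv ?_
    simp

/-- An entire function with the quasi-periods of `theta1 · τ` is a multiple of it. -/
lemma exists_eq_const_mul_theta1 (hτ : 0 < τ.im) {f : ℂ → ℂ} (hf : Differentiable ℂ f)
    (hper : ∀ z, f (z + π) = -f z)
    (hquasi : ∀ z, f (z + π * τ) = -cexp (-(π * I * τ + 2 * I * z)) * f z) :
    ∃ c, ∀ z, f z = c * theta1 z τ := by
  have hπ : (π : ℂ) ≠ 0 := by exact_mod_cast Real.pi_ne_zero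
  set s : ℂ := τ / 2 + 1 / 2 with hs
  suffices h : ∃ c, ∀ w, cexp (-(I * (π * (w - s)))) * f (π * (w - s)) =
      c * jacobiTheta₂ w τ by
    obtain ⟨c, hc⟩ := h
    refine ⟨c * (-I * cexp (π * I * τ / 4))⁻¹, fun z ↦ ?_⟩
    have h := hc (z / π + s)
    have hK : -I * cexp (π * I * τ / 4) ≠ 0 :=
      mul_ne_zero (neg_ne_zero.mpr I_ne_zero) (Complex.exp_ne_zero _)
    rw [add_sub_cancel_right, mul_div_cancel₀ z hπ, Complex.exp_neg,
      inv_mul_eq_iff_eq_mul₀ (Complex.exp_ne_zero _)] at h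
    rw [theta1_eq_jacobiTheta₂ hτ, add_assoc (z / π), ← hs, Complex.exp_add, h]
    generalize jacobiTheta₂ (z / π + s) τ = J
    field_simp
  refine exists_eq_const_mul_jacobiTheta₂ hτ (by fun_prop) (fun w ↦ ?_) (fun w ↦ ?_)
  · rw [show (π : ℂ) * (w + 1 - s) = π * (w - s) + π by ring, hper, mul_add, neg_add,
      Complex.exp_add, mul_comm I π, Complex.exp_neg (π * I), Complex.exp_pi_mul_I]
    norm_num
  · rw [show (π : ℂ) * (w + τ - s) = π * (w - s) + π * τ by ring, hquasi]
    have h : -cexp (-(I * (π * (w - s) + π * τ))) * cexp (-(π * I * τ + 2 * I * (π * (w - s)))) =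
        cexp (-π * I * (τ + 2 * w)) * cexp (-(I * (π * (w - s)))) := by
      have hneg : cexp (-(π * I)) = -1 := by
        rw [Complex.exp_neg, Complex.exp_pi_mul_I, inv_neg_one]
      rw [neg_mul, ← mul_neg_one, ← hneg, ← Complex.exp_add, ← Complex.exp_add,
        ← Complex.exp_add]
      congr 1
      simp only [hs]
      ring
    linear_combination f (π * (w - s)) * h

end theta

section ntuple

open Complex Real Filter Topology Finset

lemma prod_Icc_add_one_eq_mul {m n : ℤ} (hmn : m ≤ n) (g : ℤ → ℂ) (u : ℂ)
    (h : g (n + 1) = u * g m) : ∏ k ∈ Icc m n, g (k + 1) = u * ∏ k ∈ Icc m n, g k := by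
  have h1 : ∏ k ∈ Icc m n, g (k + 1) = ∏ k ∈ Icc (m + 1) (n + 1), g k := by
    rw [← map_add_right_Icc, prod_map]
    rfl
  rw [h1, ← insert_Icc_right_eq_Icc_add_one (by lia), prod_insert (by simp), h,
    ← insert_Icc_add_one_left_eq_Icc hmn, prod_insert (by simp), mul_assoc]

lemma sum_Icc_one_sub_self (l : ℕ) : ∑ k ∈ Icc (1 - (l : ℤ)) l, (k : ℂ) = l := by
  have h : ∑ k ∈ Icc (1 - (l : ℤ)) l, (k : ℂ) = ∑ k ∈ Icc (1 - (l : ℤ)) l, (1 - (k : ℂ)) :=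
    sum_nbij' (fun k ↦ 1 - k) (fun k ↦ 1 - k) (by simp; lia) (by simp; lia) (by simp) (by simp)
      (by simp)
  have hcard : (Icc (1 - (l : ℤ)) l).card = 2 * l := by rw [Int.card_Icc]; lia
  rw [sum_sub_distrib, sum_const, hcard, nsmul_eq_mul] at h
  push_cast at h
  linear_combination h / 2

variable {τ : ℂ}

/-- The product of the shifts of `theta1 · τ` by a set of representatives of the `2l`-torsion. -/
noncomputable def theta1TorsionProd (τ : ℂ) (l : ℕ) (z : ℂ) : ℂ :=
  ∏ k ∈ Icc (1 - (l : ℤ)) l, ∏ j ∈ Icc (1 - (l : ℤ)) l,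
    theta1 (z + k * π / (2 * l) + j * π * τ / (2 * l)) τ

lemma eventually_theta1_add_ne_zero (hτ : 0 < τ.im) (s : ℂ) :
    ∀ᶠ z in 𝓝[≠] (0 : ℂ), theta1 (z + s) τ ≠ 0 := by
  by_contra hcon
  have hd := differentiable_theta1 hτ
  have hds : Differentiable ℂ fun z ↦ theta1 (z + s) τ :=
    hd.comp (by fun_prop : Differentiable ℂ fun z : ℂ ↦ z + s)
  have h := AnalyticOnNhd.eq_of_frequently_eq (g := fun _ ↦ (0 : ℂ))
    (fun z _ ↦ hds.analyticAt z) (fun _ _ ↦ analyticAt_const) (by simpa using hcon)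
  have h0 : (fun z ↦ theta1 z τ) = fun _ ↦ 0 := by
    funext z
    simpa using congr_fun h (z - s)
  obtain ⟨d, hd0, hderiv⟩ := exists_hasDerivAt_theta1_zero hτ
  rw [h0] at hderiv
  exact hd0 (hderiv.unique (hasDerivAt_const 0 0))

lemma exists_theta1TorsionProd_ne_zero (hτ : 0 < τ.im) (l : ℕ) :
    ∃ z, theta1TorsionProd τ l z ≠ 0 := by
  have h : ∀ᶠ z in 𝓝[≠] (0 : ℂ), ∀ k ∈ Icc (1 - (l : ℤ)) l, ∀ j ∈ Icc (1 - (l : ℤ)) l,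
      theta1 (z + k * π / (2 * l) + j * π * τ / (2 * l)) τ ≠ 0 := by
    simp only [eventually_all_finset, add_assoc]
    exact fun k _ j _ ↦ eventually_theta1_add_ne_zero hτ _
  obtain ⟨z, hz⟩ := h.exists
  exact ⟨z, prod_ne_zero_iff.mpr fun k hk ↦ prod_ne_zero_iff.mpr fun j hj ↦ hz k hk j hj⟩

lemma differentiable_theta1TorsionProd (hτ : 0 < τ.im) (l : ℕ) :
    Differentiable ℂ (theta1TorsionProd τ l) := by
  refine Differentiable.fun_finsetProd fun k _ ↦ Differentiable.fun_finsetProd fun j _ ↦ ?_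
  exact (differentiable_theta1 hτ).comp
    (by fun_prop : Differentiable ℂ fun z : ℂ ↦ z + k * π / (2 * l) + j * π * τ / (2 * l))

lemma theta1TorsionProd_add_pi_div (hτ : 0 < τ.im) {l : ℕ} (hl : 1 ≤ l) (z : ℂ) :
    theta1TorsionProd τ l (z + π / (2 * l)) = theta1TorsionProd τ l z := by
  have hl0 : (l : ℂ) ≠ 0 := by norm_cast; lia
  refine Finset.prod_comm.trans (Eq.trans ?_ Finset.prod_comm)
  have h : ∀ j : ℤ, ∏ k ∈ Icc (1 - (l : ℤ)) l,
      theta1 (z + π / (2 * l) + k * π / (2 * l) + j * π * τ / (2 * l)) τ =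
      -1 * ∏ k ∈ Icc (1 - (l : ℤ)) l, theta1 (z + k * π / (2 * l) + j * π * τ / (2 * l)) τ := by
    intro j
    rw [← prod_Icc_add_one_eq_mul (by lia)
      (fun k : ℤ ↦ theta1 (z + k * π / (2 * l) + j * π * τ / (2 * l)) τ)]
    · refine prod_congr rfl fun k _ ↦ ?_
      push_cast
      ring_nf
    · rw [neg_one_mul, ← theta1_add_pi hτ]
      push_cast
      congr 1
      field_simp
      ring
  have hcard : (Icc (1 - (l : ℤ)) l).card = 2 * l := by rw [Int.card_Icc]; lia
  simp_rw [h]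
  rw [prod_mul_distrib, prod_const, hcard, pow_mul, neg_one_sq, one_pow, one_mul]

lemma theta1TorsionProd_add_pi_mul_div (hτ : 0 < τ.im) {l : ℕ} (hl : 1 ≤ l) (z : ℂ) :
    theta1TorsionProd τ l (z + π * τ / (2 * l)) =
      -cexp (-(2 * π * I * τ + 4 * l * I * z)) * theta1TorsionProd τ l z := by
  have hl0 : (l : ℂ) ≠ 0 := by norm_cast; lia
  rw [theta1TorsionProd, theta1TorsionProd]
  have h : ∀ k : ℤ, ∏ j ∈ Icc (1 - (l : ℤ)) l,
      theta1 (z + π * τ / (2 * l) + k * π / (2 * l) + j * π * τ / (2 * l)) τ =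
      -cexp (-(π * I * τ + 2 * I * (z + k * π / (2 * l) + (1 - l) * π * τ / (2 * l)))) *
        ∏ j ∈ Icc (1 - (l : ℤ)) l, theta1 (z + k * π / (2 * l) + j * π * τ / (2 * l)) τ := by
    intro k
    rw [← prod_Icc_add_one_eq_mul (by lia)
      (fun j : ℤ ↦ theta1 (z + k * π / (2 * l) + j * π * τ / (2 * l)) τ)]
    · refine prod_congr rfl fun j _ ↦ ?_
      push_cast
      ring_nf
    · push_cast
      rw [← theta1_add_pi_mul hτ]
      congr 1
      field_simp
      ring
  have hcard : (Icc (1 - (l : ℤ)) l).card = 2 * l := by rw [Int.card_Icc]; lia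
  simp_rw [h]
  rw [prod_mul_distrib, prod_neg, hcard, pow_mul, neg_one_sq, one_pow, one_mul,
    ← Complex.exp_sum]
  congr 1
  have hsum : ∑ k ∈ Icc (1 - (l : ℤ)) l,
      -(π * I * τ + 2 * I * (z + k * π / (2 * l) + (1 - l) * π * τ / (2 * l))) =
      -(2 * π * I * τ + 4 * l * I * z) + -(π * I) := by
    have : ∀ k : ℤ, -(π * I * τ + 2 * I * (z + k * π / (2 * l) + (1 - l) * π * τ / (2 * l))) =
        -(π * I * τ + 2 * I * (z + (1 - l) * π * τ / (2 * l))) + -(I * π / l) * k := by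
      intro k
      field_simp
      ring
    simp_rw [this]
    rw [sum_add_distrib, sum_const, hcard, ← mul_sum, sum_Icc_one_sub_self, nsmul_eq_mul]
    push_cast
    field_simp
    ring
  rw [hsum, Complex.exp_add, Complex.exp_neg (π * I), Complex.exp_pi_mul_I]
  norm_num

lemma exists_prod_theta4_mul_prod_theta1_eq (hτ : 0 < τ.im) {l : ℕ} (hl : 1 ≤ l) :
    ∃ C ≠ 0, ∀ z, (∏ m ∈ Icc (1 - (l : ℤ)) l, theta4 (z + m * π / (2 * l)) τ) *
      ∏ k ∈ Icc (1 - (l : ℤ)) l, ∏ j ∈ Icc (1 - (l : ℤ)) (l - 1),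
        theta1 (z + k * π / (2 * l) + j * π * τ / (2 * l)) τ =
      C * cexp (2 * l * I * z) * theta1TorsionProd τ l z := by
  have hl0 : (l : ℂ) ≠ 0 := by norm_cast; lia
  have hcard : (Icc (1 - (l : ℤ)) l).card = 2 * l := by rw [Int.card_Icc]; lia
  refine ⟨∏ k ∈ Icc (1 - (l : ℤ)) l, (-I * cexp (I * (k * π / (2 * l)) + π * I * τ / 4)),
    prod_ne_zero_iff.mpr fun k _ ↦
      mul_ne_zero (neg_ne_zero.mpr I_ne_zero) (Complex.exp_ne_zero _), fun z ↦ ?_⟩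
  have hexp : cexp (2 * l * I * z) = ∏ k ∈ Icc (1 - (l : ℤ)) l, cexp (I * z) := by
    rw [prod_const, hcard, ← Complex.exp_nat_mul]
    push_cast
    ring_nf
  rw [hexp, theta1TorsionProd, ← prod_mul_distrib, ← prod_mul_distrib, ← prod_mul_distrib]
  refine prod_congr rfl fun k _ ↦ ?_
  have hIcc : Icc (1 - (l : ℤ)) l = insert (l : ℤ) (Icc (1 - (l : ℤ)) (l - 1)) := by
    have := insert_Icc_right_eq_Icc_add_one (a := 1 - (l : ℤ)) (b := l - 1) (by lia)
    rw [sub_add_cancel] at this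
    exact this.symm
  rw [hIcc, prod_insert (by simp), theta4_eq_theta1 hτ,
    show I * (z + k * π / (2 * l)) + π * I * τ / 4 =
      I * (k * π / (2 * l)) + π * I * τ / 4 + I * z by ring, Complex.exp_add _ (I * z),
    show ((l : ℤ) : ℂ) * π * τ / (2 * l) = π * τ / 2 by push_cast; field_simp]
  ring

end ntuple

/-- Theorem 3, even case: 2l-tuple rule for θ₁(·|τ). -/
theorem theta1_even_ntuple (τ : ℂ) (hτ : 0 < τ.im) (l : ℕ) (hl : 1 ≤ l) (z : ℂ) :
    theta1 (2 * (l : ℂ) * z) τ =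
      (1 / (2 * (l : ℂ)) *
          (∏ m ∈ Finset.Icc (1 - (l : ℤ)) (l : ℤ),
            theta4 ((m : ℂ) * (Real.pi : ℂ) / (2 * (l : ℂ))) τ) *
          ∏ p ∈ (Finset.Icc (1 - (l : ℤ)) (l : ℤ) ×ˢ
              Finset.Icc (1 - (l : ℤ)) ((l : ℤ) - 1)).erase (0, 0),
            theta1 ((p.1 : ℂ) * (Real.pi : ℂ) / (2 * (l : ℂ)) +
              (p.2 : ℂ) * (Real.pi : ℂ) * τ / (2 * (l : ℂ))) τ)⁻¹ *
        ((∏ m ∈ Finset.Icc (1 - (l : ℤ)) (l : ℤ),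
            theta4 (z + (m : ℂ) * (Real.pi : ℂ) / (2 * (l : ℂ))) τ) *
          ∏ k ∈ Finset.Icc (1 - (l : ℤ)) (l : ℤ), ∏ j ∈ Finset.Icc (1 - (l : ℤ)) ((l : ℤ) - 1),
            theta1 (z + (k : ℂ) * (Real.pi : ℂ) / (2 * (l : ℂ)) +
              (j : ℂ) * (Real.pi : ℂ) * τ / (2 * (l : ℂ))) τ) := by
  have hl0 : (l : ℂ) ≠ 0 := by norm_cast; lia
  obtain ⟨C, hC, hP⟩ := exists_prod_theta4_mul_prod_theta1_eq hτ hl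
  have hQ := differentiable_theta1TorsionProd hτ l
  have hmult : ∃ c, ∀ w, C * Complex.exp (2 * l * Complex.I * (w / (2 * l))) *
      theta1TorsionProd τ l (w / (2 * l)) = c * theta1 w τ := by
    refine exists_eq_const_mul_theta1 hτ (by fun_prop) (fun w ↦ ?_) (fun w ↦ ?_)
    · rw [add_div, theta1TorsionProd_add_pi_div hτ hl, mul_add, Complex.exp_add,
        show 2 * l * Complex.I * (Real.pi / (2 * l)) = Real.pi * Complex.I by field_simp,
        Complex.exp_pi_mul_I]
      ring
    · rw [add_div, theta1TorsionProd_add_pi_mul_div hτ hl, mul_add, Complex.exp_add,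
        show -(Real.pi * Complex.I * τ + 2 * Complex.I * w) =
          2 * l * Complex.I * (Real.pi * τ / (2 * l)) +
            -(2 * Real.pi * Complex.I * τ + 4 * l * Complex.I * (w / (2 * l))) by field_simp; ring,
        Complex.exp_add]
      ring
  obtain ⟨c, hc⟩ := hmult
  have hPc : ∀ w, C * Complex.exp (2 * l * Complex.I * w) * theta1TorsionProd τ l w =
      c * theta1 (2 * l * w) τ := by
    intro w
    have h := hc (2 * l * w)
    rwa [mul_div_cancel_left₀ w (by simpa using hl0)] at h
  have hc0 : c ≠ 0 := by
    rintro rfl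
    obtain ⟨w, hw⟩ := exists_theta1TorsionProd_ne_zero hτ l
    have h := hPc w
    rw [zero_mul] at h
    exact mul_ne_zero (mul_ne_zero hC (Complex.exp_ne_zero _)) hw h
  obtain ⟨d, hd, hderiv⟩ := exists_hasDerivAt_theta1_zero hτ
  have hθ := differentiable_theta1 hτ
  have hθ4 : Differentiable ℂ fun w ↦ theta4 w τ := by
    simp_rw [theta4_eq_theta1 hτ]
    exact (by fun_prop : Differentiable ℂ fun w ↦
      -Complex.I * Complex.exp (Complex.I * w + Real.pi * Complex.I * τ / 4)).mul
      (hθ.comp (by fun_prop : Differentiable ℂ fun w : ℂ ↦ w + Real.pi * τ / 2))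
  set R : ℂ → ℂ := fun w ↦ (∏ m ∈ Finset.Icc (1 - (l : ℤ)) (l : ℤ),
      theta4 (w + (m : ℂ) * (Real.pi : ℂ) / (2 * (l : ℂ))) τ) *
    ∏ p ∈ (Finset.Icc (1 - (l : ℤ)) (l : ℤ) ×ˢ
        Finset.Icc (1 - (l : ℤ)) ((l : ℤ) - 1)).erase (0, 0),
      theta1 (w + (p.1 : ℂ) * (Real.pi : ℂ) / (2 * (l : ℂ)) +
        (p.2 : ℂ) * (Real.pi : ℂ) * τ / (2 * (l : ℂ))) τ with hR
  have hRd : Differentiable ℂ R := by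
    refine (Differentiable.fun_finsetProd fun m _ ↦ ?_).mul
      (Differentiable.fun_finsetProd fun p _ ↦ ?_)
    · exact hθ4.comp (by fun_prop : Differentiable ℂ fun w : ℂ ↦ w + m * Real.pi / (2 * l))
    · exact hθ.comp (by fun_prop : Differentiable ℂ fun w : ℂ ↦
        w + p.1 * Real.pi / (2 * l) + p.2 * Real.pi * τ / (2 * l))
  have hfac : ∀ w, theta1 w τ * R w = c * theta1 (2 * l * w) τ := by
    intro w
    have hmem : ((0, 0) : ℤ × ℤ) ∈ Finset.Icc (1 - (l : ℤ)) (l : ℤ) ×ˢ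
        Finset.Icc (1 - (l : ℤ)) ((l : ℤ) - 1) := by
      simp only [Finset.mem_product, Finset.mem_Icc]
      lia
    rw [← hPc, ← hP, ← Finset.prod_product', ← Finset.mul_prod_erase _ _ hmem, hR]
    simp only [Int.cast_zero, zero_mul, zero_div, add_zero]
    ring
  have hR0 : R 0 = c * (2 * l) := by
    have hθ0 : theta1 0 τ = 0 := by simp [theta1]
    have h1 := hderiv.mul (hRd 0).hasDerivAt
    have h2 : HasDerivAt (fun w ↦ c * theta1 (2 * l * w) τ) (c * (d * (2 * l))) 0 := by
      refine HasDerivAt.const_mul c (HasDerivAt.comp (h₂ := fun w ↦ theta1 w τ) 0 ?_ ?_)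
      · simpa using hderiv
      · simpa using (hasDerivAt_id (0 : ℂ)).const_mul (2 * (l : ℂ))
    have h3 := (h1.congr_of_eventuallyEq (.of_forall fun w ↦ (hfac w).symm)).unique h2
    rw [hθ0] at h3
    refine mul_left_cancel₀ hd ?_
    linear_combination h3
  have hK : 1 / (2 * (l : ℂ)) * R 0 = c := by
    rw [hR0]
    field_simp
  rw [hR] at hK
  simp only [zero_add] at hK
  rw [mul_assoc (1 / (2 * (l : ℂ))), hK, hP, hPc, inv_mul_cancel_left₀ hc0]
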